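/- arXiv:2305.15169 — 12 statements merged into one kernel-verified Lean document; each statement's English description precedes it below -/
import Mathlib

section
/- Let n ≥ 1, let u ∈ ℝ^n with u_j ≥ 0 for all j, let λ ∈ ℝ^n with λ_1 ≥ λ_2 ≥ … ≥ λ_n ≥ 0, and let T ∈ ℝ. Then there exists a matrix σ ∈ [0,1]^{n×n} satisfying Σ_{j=1}^n σ_{jr} ≤ 1 for every r and Σ_{r=1}^n σ_{jr} ≤ 1 for every j such that Σ_{j=1}^n Σ_{r=1}^n λ_r u_j σ_{jr} ≥ T if and only if Σ_{r=1}^n λ_r u_{(r)} ≥ T. -/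
/-- Dual potentials for the assignment problem with product costs `a i * b j`: if `a` and `b` are
antitone and nonnegative, the diagonal is optimal. -/
lemma exists_antitone_mul_dual (a b : ℕ → ℝ) (ha : Antitone a) (hb : Antitone b)
    (ha0 : ∀ k, 0 ≤ a k) (hb0 : ∀ k, 0 ≤ b k) (n : ℕ) :
    ∃ y z : ℕ → ℝ, (∀ i < n, 0 ≤ y i) ∧ (∀ i < n, 0 ≤ z i) ∧
      (∀ i, y i + z i = a i * b i) ∧ ∀ i j, a i * b j ≤ y i + z j := by
  let Y : ℕ → ℝ := fun m => ∑ k ∈ Finset.range m, (a k - a (k + 1)) * b k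
  have hY : ∀ m, Y (m + 1) = Y m + (a m - a (m + 1)) * b m := fun m =>
    Finset.sum_range_succ _ m
  have lower : ∀ i j, i ≤ j → (a i - a j) * b j ≤ Y j - Y i := by
    intro i j hij
    induction j, hij using Nat.le_induction with
    | base => simp
    | succ j hij ih =>
      rw [hY]
      nlinarith [mul_nonneg (sub_nonneg.2 (ha (hij.trans j.le_succ)))
        (sub_nonneg.2 (hb j.le_succ))]
  have upper : ∀ i j, i ≤ j → Y j - Y i ≤ (a i - a j) * b i := by
    intro i j hij
    induction j, hij using Nat.le_induction with
    | base => simp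
    | succ j hij ih =>
      rw [hY]
      nlinarith [mul_nonneg (sub_nonneg.2 (ha j.le_succ)) (sub_nonneg.2 (hb hij))]
  refine ⟨fun i => Y n - Y i + a n * b n, fun i => a i * b i - (Y n - Y i + a n * b n),
    fun i hi => ?_, fun i hi => ?_, fun i => by ring, fun i j => ?_⟩
  · nlinarith [lower i n hi.le, mul_nonneg (ha0 i) (hb0 n)]
  · nlinarith [upper i n hi.le, mul_nonneg (ha0 n) (sub_nonneg.2 (hb hi.le))]
  · rcases le_total i j with h | h
    · linarith [lower i j h]
    · linarith [upper j i h]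

/-- Extension by zero of a nonnegative antitone finite sequence is antitone and nonnegative. -/
lemma exists_antitone_nonneg_extension {n : ℕ} (f : Fin n → ℝ) (hf : Antitone f)
    (hf0 : ∀ i, 0 ≤ f i) :
    ∃ a : ℕ → ℝ, Antitone a ∧ (∀ k, 0 ≤ a k) ∧ ∀ i : Fin n, a i = f i := by
  refine ⟨fun k => if h : k < n then f ⟨k, h⟩ else 0, fun k l hkl => ?_, fun k => ?_,
    fun i => by simp⟩
  · dsimp only
    split_ifs with h₁ h₂ h₂
    · exact hf hkl
    · omega
    · exact hf0 _
    · exact le_rfl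
  · dsimp only
    split_ifs
    · exact hf0 _
    · exact le_rfl

/-- Rearrangement inequality for doubly substochastic matrices. -/
lemma sum_mul_substochastic_le {n : ℕ} (f g : Fin n → ℝ) (hf : Antitone f) (hg : Antitone g)
    (hf0 : ∀ i, 0 ≤ f i) (hg0 : ∀ i, 0 ≤ g i) (P : Fin n → Fin n → ℝ)
    (hP : ∀ i j, 0 ≤ P i j) (hcol : ∀ j, ∑ i, P i j ≤ 1) (hrow : ∀ i, ∑ j, P i j ≤ 1) :
    ∑ i, ∑ j, f i * g j * P i j ≤ ∑ i, f i * g i := by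
  obtain ⟨a, ha, ha0, haf⟩ := exists_antitone_nonneg_extension f hf hf0
  obtain ⟨b, hb, hb0, hbg⟩ := exists_antitone_nonneg_extension g hg hg0
  obtain ⟨y, z, hy, hz, hdiag, hle⟩ := exists_antitone_mul_dual a b ha hb ha0 hb0 n
  calc ∑ i, ∑ j, f i * g j * P i j
      ≤ ∑ i : Fin n, ∑ j : Fin n, (y i + z j) * P i j := by
        gcongr with i _ j _
        · exact hP i j
        · rw [← haf, ← hbg]
          exact hle i j
    _ = ∑ i : Fin n, y i * ∑ j, P i j + ∑ j : Fin n, z j * ∑ i, P i j := by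
        simp only [add_mul, Finset.sum_add_distrib, Finset.mul_sum]
        congr 1
        exact Finset.sum_comm
    _ ≤ ∑ i : Fin n, y i + ∑ j : Fin n, z j := by
        gcongr with i _ j _
        · exact mul_le_of_le_one_right (hy i i.2) (hrow i)
        · exact mul_le_of_le_one_right (hz j j.2) (hcol j)
    _ = ∑ i, f i * g i := by
        rw [← Finset.sum_add_distrib]
        exact Finset.sum_congr rfl fun i _ => by rw [hdiag, haf, hbg]


/-- For `u ∈ ℝ^n` nonnegative, `λ` nonincreasing nonnegative weights and a
threshold `T`, there exists a doubly substochastic matrix `σ ∈ [0,1]^{n×n}` with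
`Σ_j Σ_r λ_r u_j σ_{jr} ≥ T` iff `Σ_r λ_r u_{(r)} ≥ T`, where `u_{(r)} = u (π r)` for any
permutation `π` sorting `u` in nonincreasing order. -/
theorem stmt_0 (n : ℕ) (hn : 1 ≤ n)
    (u : Fin n → ℝ) (hu : ∀ j, 0 ≤ u j)
    (lam : Fin n → ℝ)
    (hlam_anti : ∀ r r' : Fin n, r ≤ r' → lam r' ≤ lam r)
    (hlam_nonneg : ∀ r, 0 ≤ lam r)
    (T : ℝ)
    (π : Equiv.Perm (Fin n))
    (hπ : ∀ r r' : Fin n, r ≤ r' → u (π r') ≤ u (π r)) :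
    (∃ σ : Fin n → Fin n → ℝ,
      (∀ j r, 0 ≤ σ j r ∧ σ j r ≤ 1) ∧
      (∀ r, ∑ j, σ j r ≤ 1) ∧
      (∀ j, ∑ r, σ j r ≤ 1) ∧
      T ≤ ∑ j, ∑ r, lam r * u j * σ j r) ↔
    T ≤ ∑ r, lam r * u (π r) := by
  constructor
  · rintro ⟨σ, hσ, hcol, hrow, hT⟩
    refine hT.trans ?_
    have key := sum_mul_substochastic_le (fun i => u (π i)) lam (fun r r' h => hπ r r' h)
      (fun r r' h => hlam_anti r r' h) (fun i => hu (π i)) hlam_nonneg (fun i r => σ (π i) r)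
      (fun i r => (hσ (π i) r).1)
      (fun r => (Equiv.sum_comp π fun j => σ j r).trans_le (hcol r)) (fun i => hrow (π i))
    rw [← Equiv.sum_comp π]
    simpa only [mul_comm (lam _)] using key
  · intro hT
    refine ⟨fun j r => if j = π r then 1 else 0, fun j r => ?_, fun r => ?_, fun j => ?_, ?_⟩
    · dsimp only
      split_ifs <;> norm_num
    · simp
    · simp [← Equiv.symm_apply_eq]
    · rw [Finset.sum_comm]
      simpa using hT
end

section
/- Let n ≥ 1, T ∈ ℝ and c ∈ ℝ^{n×n}. Define W¹ := { σ ∈ ℝ^{n×n} : σ_{jr} ≥ 0 for all j,r; Σ_{j=1}^n σ_{jr} ≤ 1 for all r; Σ_{r=1}^n σ_{jr} ≤ 1 for all j; T ≤ Σ_{j,r} c_{jr} σ_{jr} }, and W⁻ := { (σ, z) ∈ ℝ^{n×n} × ℝ : σ_{jr} ≥ 0 for all j,r; 0 ≤ z ≤ 1; Σ_{j=1}^n σ_{jr} ≤ z for all r; Σ_{r=1}^n σ_{jr} ≤ z for all j; T·z ≤ Σ_{j,r} c_{jr} σ_{jr} }. Then the convex hull of { (0, 0) } ∪ (W¹ ×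 {1}) in ℝ^{n×n} × ℝ equals W⁻. -/
/-- Perspective (Günlük–Linderoth) reformulation: the convex hull of the point
`(0,0)` together with `W¹ × {1}` (the feasible assignments with weighted value at least `T`,
at `z = 1`) equals the perspective set `W⁻`. -/
theorem stmt_2 (n : ℕ) (hn : 1 ≤ n) (T : ℝ) (c : Fin n → Fin n → ℝ) :
    convexHull ℝ
      ({((0 : Fin n → Fin n → ℝ), (0 : ℝ))} ∪
        {p : (Fin n → Fin n → ℝ) × ℝ |
          (∀ j r, 0 ≤ p.1 j r) ∧
          (∀ r, ∑ j, p.1 j r ≤ 1) ∧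
          (∀ j, ∑ r, p.1 j r ≤ 1) ∧
          T ≤ ∑ j, ∑ r, c j r * p.1 j r ∧
          p.2 = 1}) =
    {p : (Fin n → Fin n → ℝ) × ℝ |
      (∀ j r, 0 ≤ p.1 j r) ∧
      0 ≤ p.2 ∧ p.2 ≤ 1 ∧
      (∀ r, ∑ j, p.1 j r ≤ p.2) ∧
      (∀ j, ∑ r, p.1 j r ≤ p.2) ∧
      T * p.2 ≤ ∑ j, ∑ r, c j r * p.1 j r} := by
  apply Set.Subset.antisymm
  · refine convexHull_min ?_ ?_
    · rintro p (rfl | ⟨hpos, hcol, hrow, hval, hz⟩)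
      · simp
      · exact ⟨hpos, by simp [hz], by simp [hz], by simpa [hz], by simpa [hz], by simpa [hz]⟩
    · rintro ⟨σ, z⟩ ⟨hpos, hz0, hz1, hcol, hrow, hval⟩
        ⟨τ, w⟩ ⟨hpos', hw0, hw1, hcol', hrow', hval'⟩ a b ha hb hab
      simp only at *
      refine ⟨fun j r => ?_, ?_, ?_, fun r => ?_, fun j => ?_, ?_⟩ <;>
        simp only [Prod.smul_mk, Prod.mk_add_mk, Pi.add_apply, Pi.smul_apply, smul_eq_mul,
          mul_add, mul_left_comm _ a, mul_left_comm _ b, Finset.sum_add_distrib,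
          ← Finset.mul_sum]
      · have := hpos j r
        have := hpos' j r
        positivity
      · positivity
      · nlinarith
      · have := hcol r
        have := hcol' r
        gcongr
      · have := hrow j
        have := hrow' j
        gcongr
      · gcongr
  · rintro ⟨σ, z⟩ ⟨hpos, hz0, hz1, hcol, hrow, hval⟩
    simp only at *
    rcases hz0.eq_or_lt with rfl | hz
    · refine subset_convexHull ℝ _ (Or.inl (Prod.ext ?_ rfl))
      funext j r
      exact le_antisymm
        ((Finset.single_le_sum (fun i _ => hpos i r) (Finset.mem_univ j)).trans (hcol r))
        (hpos j r)
    · have scaled : ∀ {x : ℝ}, x ≤ z → z⁻¹ * x ≤ 1 := fun h =>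
        (inv_mul_le_one₀ hz).mpr h
      have hσ : (σ, z) =
          (1 - z) • ((0 : Fin n → Fin n → ℝ), (0 : ℝ)) + z • (z⁻¹ • σ, (1 : ℝ)) := by
        simp [smul_smul, hz.ne']
      rw [hσ]
      refine convex_convexHull ℝ _ ?_ ?_ (sub_nonneg.mpr hz1) hz0 (sub_add_cancel 1 z)
      · exact subset_convexHull ℝ _ (Or.inl rfl)
      refine subset_convexHull ℝ _ (Or.inr ?_)
      refine ⟨fun j r => ?_, fun r => ?_, fun j => ?_, ?_, rfl⟩ <;>
        simp only [Pi.smul_apply, smul_eq_mul, mul_left_comm _ z⁻¹, ← Finset.mul_sum]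
      · exact mul_nonneg (inv_nonneg.mpr hz0) (hpos j r)
      · exact scaled (hcol r)
      · exact scaled (hrow j)
      · rwa [le_inv_mul_iff₀ hz, mul_comm]
end

section
/- Let K ≥ 1 and let 0 ≤ a_1 ≤ a_2 ≤ … ≤ a_K be nonnegative reals. Let x ∈ {0,1}^K with Σ_{k=1}^K x_k ≤ 1, set u := Σ_{k=1}^K a_k x_k, let σ ∈ {0,1}, and set w := u·σ. Then for every k ∈ {1,…,K}: w ≤ a_k·σ + Σ_{k' > k} (a_{k'} − a_k)·x_{k'}. -/
/-- Valid inequalities (26): with nonnegative attractions `a_1 ≤ … ≤ a_K`,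
binary `x` with `Σ_k x_k ≤ 1`, `u = Σ_k a_k x_k`, binary `σ` and `w = u σ`, for every `k`:
`w ≤ a_k σ + Σ_{k' > k} (a_{k'} − a_k) x_{k'}`. -/
theorem stmt_4 (K : ℕ) (hK : 1 ≤ K)
    (a : Fin K → ℝ) (ha_nonneg : ∀ k, 0 ≤ a k)
    (ha_mono : ∀ k k' : Fin K, k ≤ k' → a k ≤ a k')
    (x : Fin K → ℝ) (hx : ∀ k, x k = 0 ∨ x k = 1) (hxsum : ∑ k, x k ≤ 1)
    (u : ℝ) (hu : u = ∑ k, a k * x k)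
    (σ : ℝ) (hσ : σ = 0 ∨ σ = 1)
    (w : ℝ) (hw : w = u * σ) :
    ∀ k : Fin K, w ≤ a k * σ + ∑ k' ∈ Finset.Ioi k, (a k' - a k) * x k' := by
  intro k
  have hx0 : ∀ j, 0 ≤ x j := fun j => by rcases hx j with h | h <;> simp [h]
  subst hu hw
  rcases hσ with rfl | rfl
  · have h : 0 ≤ ∑ j ∈ Finset.Ioi k, (a j - a k) * x j :=
      Finset.sum_nonneg fun j hj =>
        mul_nonneg (sub_nonneg.2 (ha_mono k j (Finset.mem_Ioi.1 hj).le)) (hx0 j)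
    simpa using h
  · have hsplit : ∑ j, a j * x j = a k * ∑ j, x j + ∑ j, (a j - a k) * x j := by
      rw [Finset.mul_sum, ← Finset.sum_add_distrib]
      exact Finset.sum_congr rfl fun j _ => by ring
    have htail : ∑ j, (a j - a k) * x j ≤ ∑ j ∈ Finset.Ioi k, (a j - a k) * x j := by
      rw [← Finset.sum_add_sum_compl (Finset.Ioi k)]
      refine add_le_of_nonpos_right (Finset.sum_nonpos fun j hj => ?_)
      have hjk : j ≤ k := by simpa using hj
      exact mul_nonpos_of_nonpos_of_nonneg (sub_nonpos.2 (ha_mono j k hjk)) (hx0 j)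
    have hcap := mul_le_mul_of_nonneg_left hxsum (ha_nonneg k)
    linarith
end

section
/- Let n ≥ 1 (locations) and K ≥ 1 (facility types). Let λ ∈ ℝ^n with λ_1 ≥ … ≥ λ_n ≥ 0. For each j ∈ {1,…,n} let 0 ≤ a_{j1} ≤ … ≤ a_{jK} be nonnegative reals, let x_j ∈ {0,1}^K with Σ_{k=1}^K x_{jk} ≤ 1, and set u_j := Σ_{k=1}^K a_{jk} x_{jk}. Suppose σ ∈ [0,1]^{n×n} satisfies Σ_{j=1}^n σ_{jr} ≤ 1 for every r and Σ_{r=1}^n σ_{jr} ≤ 1 for every j, and w ∈ ℝ^{n×n} satisfies, for all j, r: w_{jr} ≥ 0, w_{jr} ≤ u_j, and w_{jr} ≤ a_{jk}·σ_{jr} + Σ_{k' > k} (a_{jk'} − a_{jk})·x_{jk'} for every k ∈ {1,…,K}. Then Σ_{j=1}^n Σ_{r=1}^n λ_r w_{jr} ≤ Σ_{r=1}^n λ_r u_{(r)}. -/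
/-- Dual potentials for the assignment problem with product costs `f r * g s`, where `f` and `g`
are antitone and nonnegative: the diagonal assignment is optimal. -/
theorem exists_potentials_of_antitone {f g : ℕ → ℝ} (hf : Antitone f) (hg : Antitone g)
    (hf0 : ∀ i, 0 ≤ f i) (hg0 : ∀ i, 0 ≤ g i) (n : ℕ) (hgn : g n = 0) :
    ∃ p q : ℕ → ℝ, (∀ i, 0 ≤ p i) ∧ (∀ i, 0 ≤ q i) ∧
      (∀ i < n, p i + q i = f i * g i) ∧ ∀ r < n, ∀ s < n, f r * g s ≤ p s + q r := by
  let F : ℕ → ℝ := fun i => f i * (g i - g (i + 1))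
  let G : ℕ → ℝ := fun i => g (i + 1) * (f i - f (i + 1))
  let p : ℕ → ℝ := fun s => ∑ i ∈ Finset.Ico s n, F i
  let q : ℕ → ℝ := fun r => ∑ i ∈ Finset.Ico r n, G i
  have hdiag : ∀ i ≤ n, p i + q i = f i * g i := by
    intro i hi
    have h := Finset.sum_Ico_sub (fun i => f i * g i) hi
    have hsum : p i + q i = -∑ k ∈ Finset.Ico i n, (f (k + 1) * g (k + 1) - f k * g k) := by
      simp only [p, q, F, G, ← Finset.sum_add_distrib, ← Finset.sum_neg_distrib]
      exact Finset.sum_congr rfl fun k _ => by ring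
    rw [hsum, h, hgn]
    ring
  have hp : ∀ s r, s ≤ r → r ≤ n → f r * (g s - g r) ≤ p s - p r := by
    intro s r hsr hrn
    have h := Finset.sum_Ico_sub g hsr
    have hsplit : p s - p r = ∑ i ∈ Finset.Ico s r, F i :=
      sub_eq_of_eq_add (Finset.sum_Ico_consecutive F hsr hrn).symm
    have hgs : g s - g r = ∑ i ∈ Finset.Ico s r, (g i - g (i + 1)) := by
      rw [← neg_sub, ← h, ← Finset.sum_neg_distrib]
      simp
    rw [hsplit, hgs, Finset.mul_sum]
    refine Finset.sum_le_sum fun i hi => ?_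
    exact mul_le_mul_of_nonneg_right (hf (Finset.mem_Ico.1 hi).2.le)
      (sub_nonneg.2 (hg i.le_succ))
  have hq : ∀ r s, r ≤ s → s ≤ n → g s * (f r - f s) ≤ q r - q s := by
    intro r s hrs hsn
    have h := Finset.sum_Ico_sub f hrs
    have hsplit : q r - q s = ∑ i ∈ Finset.Ico r s, G i :=
      sub_eq_of_eq_add (Finset.sum_Ico_consecutive G hrs hsn).symm
    have hfs : f r - f s = ∑ i ∈ Finset.Ico r s, (f i - f (i + 1)) := by
      rw [← neg_sub, ← h, ← Finset.sum_neg_distrib]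
      simp
    rw [hsplit, hfs, Finset.mul_sum]
    refine Finset.sum_le_sum fun i hi => ?_
    exact mul_le_mul_of_nonneg_right (hg (Finset.mem_Ico.1 hi).2)
      (sub_nonneg.2 (hf i.le_succ))
  refine ⟨p, q, fun _ => ?_, fun _ => ?_, fun i hi => hdiag i hi.le, fun r hr s hs => ?_⟩
  · exact Finset.sum_nonneg fun i _ => mul_nonneg (hf0 i) (sub_nonneg.2 (hg i.le_succ))
  · exact Finset.sum_nonneg fun i _ => mul_nonneg (hg0 _) (sub_nonneg.2 (hf i.le_succ))
  · rcases le_total s r with h | h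
    · linarith [hp s r h hr.le, hdiag r hr.le]
    · linarith [hq r s h hs.le, hdiag s hs.le]

/-- Extension by zero of a nonnegative antitone vector to an antitone sequence. -/
theorem exists_antitone_extension {n : ℕ} {v : Fin n → ℝ} (hv : Antitone v)
    (hv0 : ∀ i, 0 ≤ v i) :
    ∃ f : ℕ → ℝ, Antitone f ∧ (∀ i, 0 ≤ f i) ∧ f n = 0 ∧ ∀ i : Fin n, f i = v i := by
  refine ⟨fun i => if h : i < n then v ⟨i, h⟩ else 0, fun i j hij => ?_, fun i => ?_, by simp,
    fun i => by simp⟩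
  · dsimp only
    split_ifs with hj hi hi
    · exact hv hij
    · omega
    · exact hv0 _
    · exact le_rfl
  · dsimp only
    split_ifs
    exacts [hv0 _, le_rfl]

/-- Rearrangement inequality for doubly substochastic matrices. -/
theorem sum_mul_substochastic_le_s5 {n : ℕ} {l v : Fin n → ℝ} (hl : Antitone l) (hv : Antitone v)
    (hl0 : ∀ i, 0 ≤ l i) (hv0 : ∀ i, 0 ≤ v i) {t : Fin n → Fin n → ℝ}
    (ht : ∀ s r, 0 ≤ t s r) (htcol : ∀ r, ∑ s, t s r ≤ 1) (htrow : ∀ s, ∑ r, t s r ≤ 1) :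
    ∑ s, ∑ r, l r * (v s * t s r) ≤ ∑ r, l r * v r := by
  obtain ⟨f, hf, hf0, -, hfl⟩ := exists_antitone_extension hl hl0
  obtain ⟨g, hg, hg0, hgn, hgv⟩ := exists_antitone_extension hv hv0
  obtain ⟨p, q, hp0, hq0, hdiag, hpq⟩ := exists_potentials_of_antitone hf hg hf0 hg0 n hgn
  calc ∑ s, ∑ r, l r * (v s * t s r)
      ≤ ∑ s : Fin n, ∑ r : Fin n, (p s * t s r + q r * t s r) := by
        refine Finset.sum_le_sum fun s _ => Finset.sum_le_sum fun r _ => ?_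
        have h := mul_le_mul_of_nonneg_right (hpq r r.2 s s.2) (ht s r)
        rw [hfl, hgv] at h
        linarith
    _ = ∑ s : Fin n, p s * ∑ r, t s r + ∑ r : Fin n, q r * ∑ s, t s r := by
        simp only [Finset.sum_add_distrib, Finset.mul_sum]
        rw [Finset.sum_comm (f := fun s r : Fin n => q r * t s r)]
    _ ≤ ∑ s : Fin n, p s + ∑ r : Fin n, q r :=
        add_le_add
          (Finset.sum_le_sum fun s _ => mul_le_of_le_one_right (hp0 s) (htrow s))
          (Finset.sum_le_sum fun r _ => mul_le_of_le_one_right (hq0 r) (htcol r))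
    _ = ∑ r, l r * v r := by
        rw [← Finset.sum_add_distrib]
        exact Finset.sum_congr rfl fun r _ => by rw [hdiag r r.2, hfl, hgv]

/-- A binary vector with sum at most one is zero or the indicator of a single index. -/
theorem binary_eq_zero_or_single {ι : Type*} [Fintype ι] {y : ι → ℝ}
    (hy : ∀ k, y k = 0 ∨ y k = 1) (hsum : ∑ k, y k ≤ 1) :
    (∀ k, y k = 0) ∨ ∃ k, y k = 1 ∧ ∀ k', k' ≠ k → y k' = 0 := by
  classical
  by_cases h : ∀ k, y k = 0
  · exact Or.inl h
  push Not at h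
  obtain ⟨k, hk⟩ := h
  have hk1 := (hy k).resolve_left hk
  refine Or.inr ⟨k, hk1, fun k' hk' => (hy k').resolve_right fun h1 => ?_⟩
  have h0 : ∀ i, 0 ≤ y i := fun i => by rcases hy i with h | h <;> rw [h] <;> norm_num
  have := Finset.add_le_sum (fun i _ => h0 i) (Finset.mem_univ k) (Finset.mem_univ k') hk'.symm
  linarith

/-- Proposition 4.4: with fractional rank-assignment variables `σ` and
linearization variables `w` satisfying the valid inequalities (26), the weighted sum
`Σ_j Σ_r λ_r w_{jr}` never exceeds the ordered median value `Σ_r λ_r u_{(r)}` of the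
partial attractions, where `u_{(r)} = u (π r)` for any sorting permutation `π`. -/
theorem stmt_5 (n K : ℕ) (hn : 1 ≤ n) (hK : 1 ≤ K)
    (lam : Fin n → ℝ)
    (hlam_anti : ∀ r r' : Fin n, r ≤ r' → lam r' ≤ lam r)
    (hlam_nonneg : ∀ r, 0 ≤ lam r)
    (a : Fin n → Fin K → ℝ) (ha_nonneg : ∀ j k, 0 ≤ a j k)
    (ha_mono : ∀ j, ∀ k k' : Fin K, k ≤ k' → a j k ≤ a j k')
    (x : Fin n → Fin K → ℝ) (hx : ∀ j k, x j k = 0 ∨ x j k = 1)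
    (hxsum : ∀ j, ∑ k, x j k ≤ 1)
    (u : Fin n → ℝ) (hu : ∀ j, u j = ∑ k, a j k * x j k)
    (σ : Fin n → Fin n → ℝ) (hσ : ∀ j r, 0 ≤ σ j r ∧ σ j r ≤ 1)
    (hσcol : ∀ r, ∑ j, σ j r ≤ 1) (hσrow : ∀ j, ∑ r, σ j r ≤ 1)
    (w : Fin n → Fin n → ℝ)
    (hw_nonneg : ∀ j r, 0 ≤ w j r)
    (hw_u : ∀ j r, w j r ≤ u j)
    (hw_vi : ∀ j r (k : Fin K),
      w j r ≤ a j k * σ j r + ∑ k' ∈ Finset.Ioi k, (a j k' - a j k) * x j k')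
    (π : Equiv.Perm (Fin n))
    (hπ : ∀ r r' : Fin n, r ≤ r' → u (π r') ≤ u (π r)) :
    ∑ j, ∑ r, lam r * w j r ≤ ∑ r, lam r * u (π r) := by
  have hu0 : ∀ j, 0 ≤ u j := fun j => by
    rw [hu]
    refine Finset.sum_nonneg fun k _ => mul_nonneg (ha_nonneg j k) ?_
    rcases hx j k with h | h <;> rw [h] <;> norm_num
  have hw : ∀ j r, w j r ≤ u j * σ j r := by
    intro j r
    rcases binary_eq_zero_or_single (hx j) (hxsum j) with h | ⟨k, hk, hne⟩
    · have huj : u j = 0 := by simp [hu, h]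
      simpa [huj] using hw_u j r
    · have huj : u j = a j k := by
        rw [hu, Finset.sum_eq_single k (fun k' _ h => by rw [hne k' h, mul_zero]) (by simp), hk,
          mul_one]
      have htail : ∑ k' ∈ Finset.Ioi k, (a j k' - a j k) * x j k' = 0 :=
        Finset.sum_eq_zero fun k' h => by rw [hne k' (Finset.mem_Ioi.1 h).ne', mul_zero]
      simpa [huj, htail] using hw_vi j r k
  calc ∑ j, ∑ r, lam r * w j r
      ≤ ∑ j, ∑ r, lam r * (u j * σ j r) :=
        Finset.sum_le_sum fun j _ => Finset.sum_le_sum fun r _ =>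
          mul_le_mul_of_nonneg_left (hw j r) (hlam_nonneg r)
    _ = ∑ s, ∑ r, lam r * (u (π s) * σ (π s) r) :=
        (Equiv.sum_comp π fun j => ∑ r, lam r * (u j * σ j r)).symm
    _ ≤ ∑ r, lam r * u (π r) :=
        sum_mul_substochastic_le_s5 (v := fun s => u (π s)) (t := fun s r => σ (π s) r)
          (fun r r' h => hlam_anti r r' h) (fun r r' h => hπ r r' h) hlam_nonneg
          (fun s => hu0 (π s)) (fun s r => (hσ (π s) r).1)
          (fun r => (Equiv.sum_comp π fun j => σ j r).trans_le (hσcol r))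
          (fun s => hσrow (π s))
end

section
/- Let n ≥ 1, K ≥ 1 and let 0 ≤ a_1 ≤ a_2 ≤ … ≤ a_K be nonnegative reals. Let x ∈ {0,1}^K with Σ_{k=1}^K x_k ≤ 1, set u := Σ_{k=1}^K a_k x_k, let σ_1, …, σ_n ∈ {0,1} with Σ_{r=1}^n σ_r ≤ 1, and set w_r := u·σ_r for each r. Then for every k ∈ {1,…,K}: Σ_{r=1}^n w_r ≤ Σ_{r=1}^n a_k·σ_r + Σ_{k' > k} (a_{k'} − a_k)·x_{k'}. -/
/-- Valid inequalities (27): with nonnegative attractions `a_1 ≤ … ≤ a_K`,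
binary `x` with `Σ_k x_k ≤ 1`, `u = Σ_k a_k x_k`, binary ranks `σ_r` with `Σ_r σ_r ≤ 1`
and `w_r = u σ_r`, for every `k`:
`Σ_r w_r ≤ Σ_r a_k σ_r + Σ_{k' > k} (a_{k'} − a_k) x_{k'}`. -/
theorem stmt_6 (n K : ℕ) (hn : 1 ≤ n) (hK : 1 ≤ K)
    (a : Fin K → ℝ) (ha_nonneg : ∀ k, 0 ≤ a k)
    (ha_mono : ∀ k k' : Fin K, k ≤ k' → a k ≤ a k')
    (x : Fin K → ℝ) (hx : ∀ k, x k = 0 ∨ x k = 1) (hxsum : ∑ k, x k ≤ 1)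
    (u : ℝ) (hu : u = ∑ k, a k * x k)
    (σ : Fin n → ℝ) (hσ : ∀ r, σ r = 0 ∨ σ r = 1) (hσsum : ∑ r, σ r ≤ 1)
    (w : Fin n → ℝ) (hw : ∀ r, w r = u * σ r) :
    ∀ k : Fin K,
      ∑ r, w r ≤ (∑ r, a k * σ r) + ∑ k' ∈ Finset.Ioi k, (a k' - a k) * x k' := by
  intro k
  have hx0 : ∀ j, 0 ≤ x j := fun j => by rcases hx j with h | h <;> simp [h]
  have hσ0 : 0 ≤ ∑ r, σ r :=
    Finset.sum_nonneg fun r _ => by rcases hσ r with h | h <;> simp [h]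
  have hT0 : 0 ≤ ∑ j ∈ Finset.Ioi k, (a j - a k) * x j :=
    Finset.sum_nonneg fun j hj =>
      mul_nonneg (sub_nonneg.2 (ha_mono k j (Finset.mem_Ioi.1 hj).le)) (hx0 j)
  have hle : ∑ j, (a j - a k) * x j ≤ ∑ j ∈ Finset.Ioi k, (a j - a k) * x j := by
    rw [← Finset.sum_sdiff (Finset.subset_univ (Finset.Ioi k))]
    refine add_le_of_nonpos_left (Finset.sum_nonpos fun j hj => ?_)
    have hjk : j ≤ k := by simpa using hj
    exact mul_nonpos_of_nonpos_of_nonneg (sub_nonpos.2 (ha_mono j k hjk)) (hx0 j)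
  have hsum : ∑ j, (a j - a k) * x j = u - a k * ∑ j, x j := by
    simp only [sub_mul, Finset.sum_sub_distrib, Finset.mul_sum, hu]
  have hu_le : u - a k ≤ ∑ j ∈ Finset.Ioi k, (a j - a k) * x j := by
    linarith [mul_le_of_le_one_right (ha_nonneg k) hxsum]
  simp only [hw, ← Finset.mul_sum]
  linarith [mul_le_mul_of_nonneg_right hu_le hσ0, mul_le_of_le_one_right hT0 hσsum]
end

section
/- Let K ≥ 1 and let x, y ∈ {0,1}^K satisfy Σ_{k=1}^K x_k ≤ 1, Σ_{k=1}^K y_k ≤ 1 and Σ_{k=1}^K k·x_k ≤ Σ_{k=1}^K k·y_k. Then for every k₀ ∈ {1,…,K}: Σ_{k ≥ k₀} x_k ≤ Σ_{k ≥ k₀} y_k. Conversely, for any x, y ∈ {0,1}^K, if Σ_{k ≥ k₀} x_k ≤ Σ_{k ≥ k₀} y_k holds for every k₀ ∈ {1,…,K}, then Σ_{k=1}^K k·x_k ≤ Σ_{k=1}^K k·y_k; hence the disaggregated inequalities dominate the aggregated one. -/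
/-- Summation by parts: the sum weighted by `k + 1` is the sum of all tail sums. -/
theorem Fin.sum_succ_mul_eq_sum_sum_Ici {K : ℕ} (x : Fin K → ℝ) :
    ∑ k : Fin K, ((k : ℕ) + 1 : ℝ) * x k = ∑ k₀ : Fin K, ∑ k ∈ Finset.Ici k₀, x k := by
  rw [Finset.sum_comm' (t' := Finset.univ) (s' := fun k => Finset.Iic k) (by simp)]
  simp [Fin.card_Iic]

/-- If `y` is nonnegative with total mass at most one and vanishes from `k₀` on, its sum
weighted by `k + 1` is at most `k₀`. -/
theorem Fin.sum_succ_mul_le_of_tail_eq_zero {K : ℕ} {y : Fin K → ℝ} (hy : ∀ k, 0 ≤ y k)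
    (hsum : ∑ k, y k ≤ 1) {k₀ : Fin K} (htail : ∀ k, k₀ ≤ k → y k = 0) :
    ∑ k : Fin K, ((k : ℕ) + 1 : ℝ) * y k ≤ (k₀ : ℕ) := by
  calc ∑ k : Fin K, ((k : ℕ) + 1 : ℝ) * y k ≤ ∑ k : Fin K, ((k₀ : ℕ) : ℝ) * y k := by
        refine Finset.sum_le_sum fun k _ => ?_
        rcases le_or_gt k₀ k with h | h
        · simp [htail k h]
        · have : ((k : ℕ) + 1 : ℝ) ≤ (k₀ : ℕ) := by exact_mod_cast h
          exact mul_le_mul_of_nonneg_right this (hy k)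
    _ = ((k₀ : ℕ) : ℝ) * ∑ k, y k := by rw [Finset.mul_sum]
    _ ≤ (k₀ : ℕ) := mul_le_of_le_one_right (Nat.cast_nonneg _) hsum

/-- inequalities (28): for binary `x, y ∈ {0,1}^K` with at most one component
equal to one, the aggregated upgrade constraint `Σ_k k x_k ≤ Σ_k k y_k` implies the
disaggregated inequalities `Σ_{k ≥ k₀} x_k ≤ Σ_{k ≥ k₀} y_k` for every `k₀`; conversely,
for any binary `x, y` the disaggregated inequalities imply the aggregated one, hence the
disaggregated inequalities dominate the aggregated one. (Types `k ∈ {1,…,K}` are indexed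
by `Fin K`, the type value being `k + 1`.) -/
theorem stmt_7 (K : ℕ) (hK : 1 ≤ K) :
    (∀ x y : Fin K → ℝ,
      (∀ k, x k = 0 ∨ x k = 1) → (∀ k, y k = 0 ∨ y k = 1) →
      (∑ k, x k ≤ 1) → (∑ k, y k ≤ 1) →
      (∑ k : Fin K, ((k : ℕ) + 1 : ℝ) * x k ≤ ∑ k : Fin K, ((k : ℕ) + 1 : ℝ) * y k) →
      ∀ k₀ : Fin K, ∑ k ∈ Finset.Ici k₀, x k ≤ ∑ k ∈ Finset.Ici k₀, y k) ∧
    (∀ x y : Fin K → ℝ,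
      (∀ k, x k = 0 ∨ x k = 1) → (∀ k, y k = 0 ∨ y k = 1) →
      (∀ k₀ : Fin K, ∑ k ∈ Finset.Ici k₀, x k ≤ ∑ k ∈ Finset.Ici k₀, y k) →
      ∑ k : Fin K, ((k : ℕ) + 1 : ℝ) * x k ≤ ∑ k : Fin K, ((k : ℕ) + 1 : ℝ) * y k) := by
  refine ⟨fun x y hx hy hxs hys hxy k₀ => ?_, fun x y _ _ h => ?_⟩
  · have hx0 : ∀ k, 0 ≤ x k := fun k => by rcases hx k with h | h <;> simp [h]
    have hy0 : ∀ k, 0 ≤ y k := fun k => by rcases hy k with h | h <;> simp [h]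
    by_cases hxt : ∀ k, k₀ ≤ k → x k = 0
    · rw [Finset.sum_eq_zero fun k hk => hxt k (Finset.mem_Ici.1 hk)]
      exact Finset.sum_nonneg fun k _ => hy0 k
    by_cases hyt : ∀ k, k₀ ≤ k → y k = 0
    · push Not at hxt
      obtain ⟨k, hk, hxk⟩ := hxt
      have hle := Fin.sum_succ_mul_le_of_tail_eq_zero hy0 hys hyt
      have hge : ((k : ℕ) + 1 : ℝ) * x k ≤ ∑ k : Fin K, ((k : ℕ) + 1 : ℝ) * x k :=
        Finset.single_le_sum (f := fun k : Fin K => ((k : ℕ) + 1 : ℝ) * x k)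
          (fun i _ => mul_nonneg (by positivity) (hx0 i)) (Finset.mem_univ k)
      rw [(hx k).resolve_left hxk, mul_one] at hge
      have hkk : ((k₀ : ℕ) : ℝ) ≤ (k : ℕ) := by exact_mod_cast hk
      linarith
    · push Not at hyt
      obtain ⟨l, hl, hyl⟩ := hyt
      calc ∑ k ∈ Finset.Ici k₀, x k ≤ ∑ k, x k :=
            Finset.sum_le_sum_of_subset_of_nonneg (Finset.subset_univ _) fun k _ _ => hx0 k
        _ ≤ 1 := hxs
        _ = y l := ((hy l).resolve_left hyl).symm
        _ ≤ ∑ k ∈ Finset.Ici k₀, y k :=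
            Finset.single_le_sum (fun i _ => hy0 i) (Finset.mem_Ici.2 hl)
  · rw [Fin.sum_succ_mul_eq_sum_sum_Ici, Fin.sum_succ_mul_eq_sum_sum_Ici]
    exact Finset.sum_le_sum fun k₀ _ => h k₀
end

section
/- Let n ≥ 1 (locations), K ≥ 1 (types), T ∈ ℝ, λ ∈ ℝ^n with λ_r ≥ 0 for all r, and for each j ∈ {1,…,n} let a_{j1}, …, a_{jK} ≥ 0. Suppose (x, z, u, w, σ) satisfies: x ∈ {0,1}^{n×K} with Σ_k x_{jk} ≤ 1 for every j; u_j = Σ_k a_{jk} x_{jk} for every j; z ∈ [0,1]; σ ∈ {0,1}^{n×n} with Σ_j σ_{jr} ≤ z for every r and Σ_r σ_{jr} ≤ z for every j; w ∈ ℝ^{n×n} with 0 ≤ w_{jr}, w_{jr} ≤ a_{jK}·σ_{jr} and w_{jr} ≤ u_j for all j, r; and T·z ≤ Σ_{j,r} λ_r w_{jr}. Define σ'_{jr} := σ_{jr} if Σ_k x_{jk} = 1 and σ'_{jr} := 0 otherwise, and w' := w. Then (x, z, u, w', σ') satisfies all the same constraints, Σ_{j,r} λ_r w'_{jr} = Σ_{j,r}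 λ_r w_{jr}, and additionally Σ_{r=1}^n σ'_{jr} ≤ Σ_{k=1}^K x_{jk} for every j. -/
/-- A binary family whose sum is at most `1` but not equal to `1` vanishes. -/
theorem eq_zero_of_sum_ne_one {ι : Type*} [Fintype ι] {x : ι → ℝ}
    (hx : ∀ k, x k = 0 ∨ x k = 1) (hle : ∑ k, x k ≤ 1) (hne : ∑ k, x k ≠ 1) (k : ι) :
    x k = 0 := by
  refine (hx k).resolve_right fun hk => hne (hle.antisymm ?_)
  rw [← hk]
  refine Finset.single_le_sum (f := x) (fun i _ => ?_) (Finset.mem_univ k)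
  rcases hx i with h | h <;> simp [h]

open Classical in
/-- Proposition 4.7, inequalities (29): given a feasible solution
`(x, z, u, w, σ)` of the (SL) constraints for a fixed customer/period/scenario, setting
`σ'_{jr} := σ_{jr}` if `Σ_k x_{jk} = 1` and `σ'_{jr} := 0` otherwise, and `w' := w`,
yields a solution satisfying all the same constraints with the same objective
contribution, which additionally satisfies `Σ_r σ'_{jr} ≤ Σ_k x_{jk}` for every `j`. -/
theorem stmt_8 (n K : ℕ) (hn : 1 ≤ n) (hK : 1 ≤ K) (T : ℝ)
    (lam : Fin n → ℝ) (hlam : ∀ r, 0 ≤ lam r)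
    (a : Fin n → Fin K → ℝ) (ha : ∀ j k, 0 ≤ a j k)
    (x : Fin n → Fin K → ℝ) (hx : ∀ j k, x j k = 0 ∨ x j k = 1)
    (hxsum : ∀ j, ∑ k, x j k ≤ 1)
    (u : Fin n → ℝ) (hu : ∀ j, u j = ∑ k, a j k * x j k)
    (z : ℝ) (hz0 : 0 ≤ z) (hz1 : z ≤ 1)
    (σ : Fin n → Fin n → ℝ) (hσbin : ∀ j r, σ j r = 0 ∨ σ j r = 1)
    (hσcol : ∀ r, ∑ j, σ j r ≤ z) (hσrow : ∀ j, ∑ r, σ j r ≤ z)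
    (w : Fin n → Fin n → ℝ) (hw0 : ∀ j r, 0 ≤ w j r)
    (hwσ : ∀ j r, w j r ≤ a j ⟨K - 1, by omega⟩ * σ j r)
    (hwu : ∀ j r, w j r ≤ u j)
    (hcov : T * z ≤ ∑ j, ∑ r, lam r * w j r) :
    let σ' : Fin n → Fin n → ℝ := fun j r => if (∑ k, x j k) = 1 then σ j r else 0
    let w' : Fin n → Fin n → ℝ := w
    (∀ j r, σ' j r = 0 ∨ σ' j r = 1) ∧
    (∀ r, ∑ j, σ' j r ≤ z) ∧
    (∀ j, ∑ r, σ' j r ≤ z) ∧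
    (∀ j r, 0 ≤ w' j r) ∧
    (∀ j r, w' j r ≤ a j ⟨K - 1, by omega⟩ * σ' j r) ∧
    (∀ j r, w' j r ≤ u j) ∧
    (T * z ≤ ∑ j, ∑ r, lam r * w' j r) ∧
    (∑ j, ∑ r, lam r * w' j r = ∑ j, ∑ r, lam r * w j r) ∧
    (∀ j, ∑ r, σ' j r ≤ ∑ k, x j k) := by
  intro σ' w'
  have hσ0 : ∀ j r, 0 ≤ σ j r := fun j r => by
    rcases hσbin j r with h | h <;> simp [h]
  have hle : ∀ j r, σ' j r ≤ σ j r := fun j r => by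
    dsimp only [σ']
    split_ifs
    exacts [le_rfl, hσ0 j r]
  refine ⟨fun j r => ?_, fun r => (Finset.sum_le_sum fun j _ => hle j r).trans (hσcol r),
    fun j => (Finset.sum_le_sum fun r _ => hle j r).trans (hσrow j), hw0, fun j r => ?_, hwu,
    hcov, rfl, fun j => ?_⟩
  · dsimp only [σ']
    split_ifs
    exacts [hσbin j r, Or.inl rfl]
  · dsimp only [σ', w']
    split_ifs with h
    · exact hwσ j r
    · have hu0 : u j = 0 := by
        rw [hu, Finset.sum_eq_zero]
        intro k _
        rw [eq_zero_of_sum_ne_one (hx j) (hxsum j) h k, mul_zero]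
      rw [mul_zero, ← hu0]
      exact hwu j r
  · dsimp only [σ']
    split_ifs with h
    · rw [h]
      exact (hσrow j).trans hz1
    · rw [Finset.sum_const_zero]
      exact Finset.sum_nonneg fun k _ => by rcases hx j k with h | h <;> simp [h]
end

section
/- Let n ≥ 1 (locations), K ≥ 1 (types), let λ ∈ ℝ^n with λ_1 ≥ … ≥ λ_n ≥ 0, and for each j ∈ {1,…,n} let a_{j1}, …, a_{jK} ≥ 0. Let x ∈ {0,1}^{n×K} with Σ_{k=1}^K x_{jk} ≤ 1 for every j, and set ū_j := Σ_{k=1}^K a_{jk} x_{jk}. Then the maximum of Σ_{j=1}^n Σ_{k=1}^K Σ_{r=1}^n λ_r a_{jk} σ_{jkr} over all σ ∈ ℝ^{n×K×n} satisfying σ_{jkr} ≥ 0, Σ_{j,k} σ_{jkr} ≤ 1 for every r, and Σ_{r} σ_{jkr} ≤ x_{jk} for every j, k, equals Σ_{r=1}^n λ_r ū_{(r)}. Moreover, the maximum is attained by an integral solution: taking any permutation τ of {1,…,n} with ū_{τ(1)} ≥ … ≥ ū_{τ(n)}, the solution that sets σ_{j k̄_j τ^{-1}(j)} = 1 for each j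 with an open facility (where k̄_j is the unique k with x_{jk} = 1) and all other entries to 0 is feasible and optimal. -/
/-- Abel summation: a nonnegative nonincreasing weighting of a sequence with nonnegative partial
sums has nonnegative total. -/
theorem sum_mul_nonneg_of_antitone {n : ℕ} {b f : Fin n → ℝ} (hb : Antitone b)
    (hb0 : ∀ i, 0 ≤ b i) (hf : ∀ l, 0 ≤ ∑ i with i ≤ l, f i) : 0 ≤ ∑ i, b i * f i := by
  induction n with
  | zero => simp
  | succ n ih =>
    have h := ih (b := fun i => b i.castSucc - b (Fin.last n)) (f := fun i => f i.castSucc)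
      (fun i j hij => sub_le_sub_right (hb (Fin.castSucc_le_castSucc_iff.2 hij)) _)
      (fun i => sub_nonneg.2 (hb (Fin.le_last _)))
      (fun l => by
        have := hf l.castSucc
        rw [Finset.sum_filter, Fin.sum_univ_castSucc] at this
        rw [Finset.sum_filter]
        simpa [Fin.castSucc_lt_last] using this)
    have hlast := hf (Fin.last n)
    rw [Finset.filter_true_of_mem (fun i _ => Fin.le_last i), Fin.sum_univ_castSucc] at hlast
    have hmul := mul_nonneg (hb0 (Fin.last n)) hlast
    simp only [sub_mul, Finset.sum_sub_distrib, ← Finset.mul_sum] at h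
    rw [Fin.sum_univ_castSucc]
    linarith

theorem sum_mul_le_sum_mul_of_antitone {n : ℕ} {b d e : Fin n → ℝ} (hb : Antitone b)
    (hb0 : ∀ i, 0 ≤ b i) (h : ∀ l, ∑ i with i ≤ l, d i ≤ ∑ i with i ≤ l, e i) :
    ∑ i, b i * d i ≤ ∑ i, b i * e i := by
  have := sum_mul_nonneg_of_antitone (f := fun i => e i - d i) hb hb0 (fun l => by
    simpa only [Finset.sum_sub_distrib, sub_nonneg] using h l)
  simpa only [mul_sub, Finset.sum_sub_distrib, sub_nonneg] using this

/-- The leading `m × l` block of a doubly substochastic matrix has total at most `min m l`. -/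
theorem sum_block_le_of_substochastic {n : ℕ} {p : Fin n → Fin n → ℝ} (hp : ∀ i r, 0 ≤ p i r)
    (hrow : ∀ i, ∑ r, p i r ≤ 1) (hcol : ∀ r, ∑ i, p i r ≤ 1) (l m : Fin n) :
    ∑ r with r ≤ m, ∑ i with i ≤ l, p i r ≤ ∑ r with r ≤ m, if r ≤ l then (1 : ℝ) else 0 := by
  rcases le_total m l with hml | hlm
  · refine Finset.sum_le_sum fun r hr => ?_
    rw [if_pos ((Finset.mem_filter.1 hr).2.trans hml)]
    exact (Finset.sum_le_univ_sum_of_nonneg fun i => hp i r).trans (hcol r)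
  · rw [← Finset.sum_filter, Finset.filter_filter, Finset.sum_comm]
    have hset : (Finset.univ.filter fun r : Fin n => r ≤ m ∧ r ≤ l)
        = Finset.univ.filter fun r => r ≤ l :=
      Finset.filter_congr fun r _ => ⟨And.right, fun h => ⟨h.trans hlm, h⟩⟩
    rw [hset]
    exact Finset.sum_le_sum fun i _ =>
      (Finset.sum_le_univ_sum_of_nonneg fun r => hp i r).trans (hrow i)

/-- Rearrangement inequality for doubly substochastic matrices. -/
theorem sum_mul_substochastic_le_s10 {n : ℕ} {b c : Fin n → ℝ} (hb : Antitone b) (hb0 : ∀ i, 0 ≤ b i)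
    (hc : Antitone c) (hc0 : ∀ i, 0 ≤ c i) {p : Fin n → Fin n → ℝ} (hp : ∀ i r, 0 ≤ p i r)
    (hrow : ∀ i, ∑ r, p i r ≤ 1) (hcol : ∀ r, ∑ i, p i r ≤ 1) :
    ∑ i, b i * ∑ r, c r * p i r ≤ ∑ i, b i * c i := by
  refine sum_mul_le_sum_mul_of_antitone hb hb0 fun l => ?_
  have h := sum_mul_le_sum_mul_of_antitone hc hc0 (sum_block_le_of_substochastic hp hrow hcol l)
  simp only [mul_ite, mul_one, mul_zero, ← Finset.sum_filter] at h
  rw [Finset.sum_comm]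
  simpa only [Finset.mul_sum] using h

/-- If at most one entry of a binary vector equals one, it selects a single coordinate. -/
theorem sum_mul_eq_of_binary {κ : Type*} [Fintype κ] {x : κ → ℝ} (hx : ∀ k, x k = 0 ∨ x k = 1)
    (hsum : ∑ k, x k ≤ 1) (a : κ → ℝ) {k : κ} (hk : x k = 1) : ∑ i, a i * x i = a k := by
  classical
  have hx0 : ∀ i, 0 ≤ x i := fun i => by rcases hx i with h | h <;> simp [h]
  rw [Finset.sum_eq_single k, hk, mul_one]
  · intro i _ hik
    have hpair := Finset.sum_le_univ_sum_of_nonneg hx0 (s := {i, k})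
    rw [Finset.sum_pair hik] at hpair
    have : x i = 0 := by linarith [hx0 i]
    rw [this, mul_zero]
  · simp

open Classical in
/-- Theorem 5.1, primal optimality: the maximum of the assignment LP (SUB)
equals the ordered median value `Σ_r λ_r ū_{(r)}` of the induced attractions
`ū_j = Σ_k a_{jk} x_{jk}`, and it is attained by the integral sorting solution
`σ*_{jkr} = 1` iff `x_{jk} = 1` and `τ r = j`, for any permutation `τ` sorting `ū`
in nonincreasing order. -/
theorem stmt_10 (n K : ℕ) (hn : 1 ≤ n) (hK : 1 ≤ K)
    (lam : Fin n → ℝ)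
    (hlam_anti : ∀ r r' : Fin n, r ≤ r' → lam r' ≤ lam r)
    (hlam_nonneg : ∀ r, 0 ≤ lam r)
    (a : Fin n → Fin K → ℝ) (ha : ∀ j k, 0 ≤ a j k)
    (x : Fin n → Fin K → ℝ) (hx : ∀ j k, x j k = 0 ∨ x j k = 1)
    (hxsum : ∀ j, ∑ k, x j k ≤ 1)
    (ubar : Fin n → ℝ) (hubar : ∀ j, ubar j = ∑ k, a j k * x j k)
    (τ : Equiv.Perm (Fin n))
    (hτ : ∀ r r' : Fin n, r ≤ r' → ubar (τ r') ≤ ubar (τ r)) :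
    IsGreatest
      {v : ℝ | ∃ σ : Fin n → Fin K → Fin n → ℝ,
        (∀ j k r, 0 ≤ σ j k r) ∧
        (∀ r, ∑ j, ∑ k, σ j k r ≤ 1) ∧
        (∀ j k, ∑ r, σ j k r ≤ x j k) ∧
        v = ∑ j, ∑ k, ∑ r, lam r * a j k * σ j k r}
      (∑ r, lam r * ubar (τ r)) ∧
    (let σstar : Fin n → Fin K → Fin n → ℝ :=
        fun j k r => if x j k = 1 ∧ τ r = j then 1 else 0
     (∀ j k r, 0 ≤ σstar j k r) ∧
     (∀ r, ∑ j, ∑ k, σstar j k r ≤ 1) ∧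
     (∀ j k, ∑ r, σstar j k r ≤ x j k) ∧
     ∑ j, ∑ k, ∑ r, lam r * a j k * σstar j k r = ∑ r, lam r * ubar (τ r)) := by
  have hx0 : ∀ j k, 0 ≤ x j k := fun j k => by rcases hx j k with h | h <;> simp [h]
  have hub0 : ∀ j, 0 ≤ ubar j := fun j => by
    rw [hubar]; exact Finset.sum_nonneg fun k _ => mul_nonneg (ha j k) (hx0 j k)
  have hvalue : ∀ σ : Fin n → Fin K → Fin n → ℝ, (∀ j k r, 0 ≤ σ j k r) →
      (∀ j k, ∑ r, σ j k r ≤ x j k) →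
      ∑ j, ∑ k, ∑ r, lam r * a j k * σ j k r = ∑ j, ubar j * ∑ r, lam r * ∑ k, σ j k r := by
    intro σ h0 hle
    refine Finset.sum_congr rfl fun j _ => ?_
    simp only [Finset.mul_sum]
    rw [Finset.sum_comm]
    refine Finset.sum_congr rfl fun r _ => Finset.sum_congr rfl fun k _ => ?_
    rcases hx j k with h | h
    · have : σ j k r = 0 := le_antisymm
        ((Finset.single_le_sum (fun r _ => h0 j k r) (Finset.mem_univ r)).trans
          ((hle j k).trans h.le)) (h0 j k r)
      simp [this]
    · rw [hubar, sum_mul_eq_of_binary (hx j) (hxsum j) (a j) h]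
      ring
  set σstar : Fin n → Fin K → Fin n → ℝ :=
    fun j k r => if x j k = 1 ∧ τ r = j then 1 else 0 with hσstar
  have hσ : ∀ j k r, σstar j k r = if r = τ.symm j then x j k else 0 := fun j k r => by
    rcases hx j k with h | h <;> simp [hσstar, h, Equiv.eq_symm_apply]
  have hσ' : ∀ j k r, σstar j k r = if j = τ r then x j k else 0 := fun j k r => by
    simp only [hσ, Equiv.eq_symm_apply, eq_comm]
  have hnonneg : ∀ j k r, 0 ≤ σstar j k r := fun j k r => by
    rw [hσ]; split_ifs; exacts [hx0 j k, le_rfl]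
  have hcol : ∀ r, ∑ j, ∑ k, σstar j k r ≤ 1 := fun r => by
    rw [Finset.sum_comm]
    simpa [hσ'] using hxsum (τ r)
  have hrow : ∀ j k, ∑ r, σstar j k r ≤ x j k := fun j k => by simp [hσ]
  have hopt : ∑ j, ∑ k, ∑ r, lam r * a j k * σstar j k r = ∑ r, lam r * ubar (τ r) := by
    rw [← Equiv.sum_comp τ]
    refine Finset.sum_congr rfl fun i _ => ?_
    simp [hσ, hubar, Finset.mul_sum, mul_assoc]
  refine ⟨⟨⟨σstar, hnonneg, hcol, hrow, hopt.symm⟩, ?_⟩, hnonneg, hcol, hrow, hopt⟩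
  rintro v ⟨σ, h0, hc, hr, rfl⟩
  rw [hvalue σ h0 hr, ← Equiv.sum_comp τ]
  have h := sum_mul_substochastic_le_s10 (b := fun i => ubar (τ i)) (c := lam)
    (p := fun i r => ∑ k, σ (τ i) k r) (fun i j hij => hτ i j hij) (fun i => hub0 _)
    (fun i j hij => hlam_anti i j hij) hlam_nonneg
    (fun i r => Finset.sum_nonneg fun k _ => h0 _ k r)
    (fun i => by
      rw [Finset.sum_comm]
      exact (Finset.sum_le_sum fun k _ => hr (τ i) k).trans (hxsum _))
    (fun r => (Equiv.sum_comp τ fun j => ∑ k, σ j k r).trans_le (hc r))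
  simpa only [mul_comm (lam _) (ubar _)] using h
end

section
/- Let n ≥ 1, let λ ∈ ℝ^n with λ_1 ≥ λ_2 ≥ … ≥ λ_n ≥ 0, and let ū ∈ ℝ^n with ū_1 ≥ ū_2 ≥ … ≥ ū_n ≥ 0. Define γ_r := Σ_{r'=r}^{n−1} (λ_{r'} − λ_{r'+1})·ū_{r'} + λ_n·ū_n for r ∈ {1,…,n}, and δ_j := Σ_{r'=j}^{n−1} λ_{r'+1}·(ū_{r'} − ū_{r'+1}) for j ∈ {1,…,n}. Then γ_r + δ_j ≥ λ_r·ū_j for all r, j ∈ {1,…,n}. -/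
/-- A sequence that is nonincreasing from step to step on `{1, …, n}` is antitone there. -/
theorem le_of_succ_le_on {n : ℕ} {u : ℕ → ℝ}
    (hu : ∀ r, 1 ≤ r → r < n → u (r + 1) ≤ u r) {j k : ℕ}
    (hj : 1 ≤ j) (hjk : j ≤ k) (hk : k ≤ n) : u k ≤ u j := by
  induction k, hjk using Nat.le_induction with
  | base => exact le_rfl
  | succ k hjk ih => exact (hu k (hj.trans hjk) hk).trans (ih (by omega))

/-- Telescoping of successive decrements over a half-open interval. -/
theorem sum_Ico_sub_succ (f : ℕ → ℝ) {m n : ℕ} (hmn : m ≤ n) :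
    ∑ k ∈ Finset.Ico m n, (f k - f (k + 1)) = f m - f n := by
  rw [← neg_sub (f n), ← Finset.sum_Ico_sub f hmn, ← Finset.sum_neg_distrib]
  exact Finset.sum_congr rfl fun _ _ => (neg_sub _ _).symm

/-- Discrete summation by parts. -/
theorem sum_Ico_by_parts (f g : ℕ → ℝ) {m n : ℕ} (hmn : m ≤ n) :
    ∑ k ∈ Finset.Ico m n, (f k - f (k + 1)) * g k
      + ∑ k ∈ Finset.Ico m n, f (k + 1) * (g k - g (k + 1)) = f m * g m - f n * g n := by
  rw [← Finset.sum_add_distrib, ← sum_Ico_sub_succ (fun k => f k * g k) hmn]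
  exact Finset.sum_congr rfl fun _ _ => by ring


/-- Theorem 5.1, dual feasibility: with nonincreasing nonnegative weights
`λ_1 ≥ … ≥ λ_n ≥ 0` and sorted attractions `ū_1 ≥ … ≥ ū_n ≥ 0`, the dual multipliers
`γ_r = Σ_{r'=r}^{n−1}(λ_{r'} − λ_{r'+1}) ū_{r'} + λ_n ū_n` and
`δ_j = Σ_{r'=j}^{n−1} λ_{r'+1}(ū_{r'} − ū_{r'+1})` satisfy `γ_r + δ_j ≥ λ_r ū_j`
for all `r, j ∈ {1,…,n}`. -/
theorem stmt_11 (n : ℕ) (hn : 1 ≤ n)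
    (lam ubar : ℕ → ℝ)
    (hlam_anti : ∀ r, 1 ≤ r → r < n → lam (r + 1) ≤ lam r)
    (hlam_last : 0 ≤ lam n)
    (hubar_anti : ∀ r, 1 ≤ r → r < n → ubar (r + 1) ≤ ubar r)
    (hubar_last : 0 ≤ ubar n)
    (γ δ : ℕ → ℝ)
    (hγ : ∀ r, γ r =
      (∑ r' ∈ Finset.Ico r n, (lam r' - lam (r' + 1)) * ubar r') + lam n * ubar n)
    (hδ : ∀ j, δ j =
      ∑ r' ∈ Finset.Ico j n, lam (r' + 1) * (ubar r' - ubar (r' + 1))) :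
    ∀ r j, 1 ≤ r → r ≤ n → 1 ≤ j → j ≤ n → lam r * ubar j ≤ γ r + δ j := by
  intro r j hr hrn hj hjn
  have hparts := sum_Ico_by_parts lam ubar hjn
  rw [hγ, hδ]
  rcases le_total r j with hrj | hjr
  · have hsplit := Finset.sum_Ico_consecutive
      (fun k => (lam k - lam (k + 1)) * ubar k) hrj hjn
    have hbound : (lam r - lam j) * ubar j
        ≤ ∑ k ∈ Finset.Ico r j, (lam k - lam (k + 1)) * ubar k := by
      rw [← sum_Ico_sub_succ lam hrj, Finset.sum_mul]
      refine Finset.sum_le_sum fun k hk => ?_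
      obtain ⟨hrk, hkj⟩ := Finset.mem_Ico.mp hk
      exact mul_le_mul_of_nonneg_left
        (le_of_succ_le_on hubar_anti (hr.trans hrk) hkj.le hjn)
        (sub_nonneg.mpr (hlam_anti k (hr.trans hrk) (hkj.trans_le hjn)))
    linarith
  · have hsplit := Finset.sum_Ico_consecutive
      (fun k => (lam k - lam (k + 1)) * ubar k) hjr hrn
    have hbound : ∑ k ∈ Finset.Ico j r, (lam k - lam (k + 1)) * ubar k
        ≤ (lam j - lam r) * ubar j := by
      rw [← sum_Ico_sub_succ lam hjr, Finset.sum_mul]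
      refine Finset.sum_le_sum fun k hk => ?_
      obtain ⟨hjk, hkr⟩ := Finset.mem_Ico.mp hk
      exact mul_le_mul_of_nonneg_left
        (le_of_succ_le_on hubar_anti hj hjk (hkr.le.trans hrn))
        (sub_nonneg.mpr (hlam_anti k (hj.trans hjk) (hkr.trans_le hrn)))
    linarith
end

section
/- Let n ≥ 1, let λ ∈ ℝ^n with λ_1 ≥ λ_2 ≥ … ≥ λ_n ≥ 0, and let ū ∈ ℝ^n with ū_1 ≥ ū_2 ≥ … ≥ ū_n ≥ 0. Define γ_r := Σ_{r'=r}^{n−1} (λ_{r'} − λ_{r'+1})·ū_{r'} + λ_n·ū_n. Let a ≥ 0 and define r* := n if ū_r ≥ a for all r, and r* := min{ r ∈ {1,…,n} : ū_r < a } otherwise. Then λ_r·a − γ_r ≤ λ_{r*}·a − γ_{r*} for every r ∈ {1,…,n}; that is, the function r ↦ λ_r·a − γ_r attains its maximum at r = r*. In particular, the consecutive differences satisfy (λ_{r+1}·a − γ_{r+1}) − (λ_r·a − γ_r) = (λ_r − λ_{r+1})·(ū_r − a) for every r ∈ {1,…,n−1}. -/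
/-- A function on `ℕ` with nonincreasing steps from `p` to `m` is at most `f p` there. -/
theorem le_of_step_antitone {α : Type*} [Preorder α] {f : ℕ → α} {p m : ℕ}
    (h : ∀ r, p ≤ r → r < m → f (r + 1) ≤ f r) {r : ℕ} (hpr : p ≤ r) (hrm : r ≤ m) :
    f r ≤ f p := by
  induction r, hpr using Nat.le_induction with
  | base => exact le_rfl
  | succ k hk ih => exact (h k hk hrm).trans (ih (Nat.le_of_succ_le hrm))

/-- A function on `ℕ` with nondecreasing steps from `l` to `p` is at least `f l` there. -/
theorem le_of_step_monotone {α : Type*} [Preorder α] {f : ℕ → α} {l p : ℕ}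
    (h : ∀ r, l ≤ r → r < p → f r ≤ f (r + 1)) {r : ℕ} (hlr : l ≤ r) (hrp : r ≤ p) :
    f l ≤ f r :=
  le_of_step_antitone (α := αᵒᵈ) h hlr hrp


/-- Theorem 5.1, locating the optimal rank `r*`: with nonincreasing
nonnegative weights `λ`, sorted attractions `ū`, the multipliers `γ_r` of Algorithm 2,
and `a ≥ 0`, setting `r* := n` if `ū_r ≥ a` for all `r` and
`r* := min{r : ū_r < a}` otherwise, the map `r ↦ λ_r a − γ_r` attains its maximum at
`r = r*`; in particular its consecutive differences equal `(λ_r − λ_{r+1})(ū_r − a)`. -/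
theorem stmt_13 (n : ℕ) (hn : 1 ≤ n)
    (lam ubar : ℕ → ℝ)
    (hlam_anti : ∀ r, 1 ≤ r → r < n → lam (r + 1) ≤ lam r)
    (hlam_last : 0 ≤ lam n)
    (hubar_anti : ∀ r, 1 ≤ r → r < n → ubar (r + 1) ≤ ubar r)
    (hubar_last : 0 ≤ ubar n)
    (γ : ℕ → ℝ)
    (hγ : ∀ r, γ r =
      (∑ r' ∈ Finset.Ico r n, (lam r' - lam (r' + 1)) * ubar r') + lam n * ubar n)
    (a : ℝ) (ha : 0 ≤ a)
    (rstar : ℕ)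
    (hrstar_all : (∀ r, 1 ≤ r → r ≤ n → a ≤ ubar r) → rstar = n)
    (hrstar_min : (∃ r, 1 ≤ r ∧ r ≤ n ∧ ubar r < a) →
      1 ≤ rstar ∧ rstar ≤ n ∧ ubar rstar < a ∧ ∀ r, 1 ≤ r → r < rstar → a ≤ ubar r) :
    (∀ r, 1 ≤ r → r ≤ n → lam r * a - γ r ≤ lam rstar * a - γ rstar) ∧
    (∀ r, 1 ≤ r → r < n →
      (lam (r + 1) * a - γ (r + 1)) - (lam r * a - γ r) =
        (lam r - lam (r + 1)) * (ubar r - a)) := by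
  have hdiff : ∀ r, 1 ≤ r → r < n →
      (lam (r + 1) * a - γ (r + 1)) - (lam r * a - γ r) =
        (lam r - lam (r + 1)) * (ubar r - a) := by
    intro r _ hr
    rw [hγ r, hγ (r + 1), Finset.sum_eq_sum_Ico_succ_bot hr]
    ring
  have hpeak : 1 ≤ rstar ∧ rstar ≤ n ∧ (∀ r, 1 ≤ r → r < rstar → a ≤ ubar r) ∧
      ∀ r, rstar ≤ r → r < n → ubar r ≤ a := by
    by_cases hall : ∀ r, 1 ≤ r → r ≤ n → a ≤ ubar r
    · obtain rfl := hrstar_all hall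
      exact ⟨hn, le_rfl, fun r h1 hr => hall r h1 hr.le, fun r h1 h2 => absurd h1 h2.not_ge⟩
    · push Not at hall
      obtain ⟨h1, hle, hlt, hmin⟩ := hrstar_min hall
      refine ⟨h1, hle, hmin, fun r hr hrn => le_trans ?_ hlt.le⟩
      exact le_of_step_antitone (fun k hk => hubar_anti k (h1.trans hk)) hr hrn.le
  obtain ⟨hpos, hle, hbelow, habove⟩ := hpeak
  refine ⟨fun r h1 hrn => ?_, hdiff⟩
  rcases le_total r rstar with hr | hr
  · refine le_of_step_monotone (f := fun k => lam k * a - γ k) (fun k hk hkr => ?_) hr le_rfl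
    have hkn := hkr.trans_le hle
    rw [← sub_nonneg, hdiff k (h1.trans hk) hkn]
    exact mul_nonneg (sub_nonneg.2 (hlam_anti k (h1.trans hk) hkn))
      (sub_nonneg.2 (hbelow k (h1.trans hk) hkr))
  · refine le_of_step_antitone (f := fun k => lam k * a - γ k) (fun k hk hkn => ?_) hr hrn
    have hk1 := hpos.trans hk
    rw [← sub_nonpos, hdiff k hk1 hkn]
    exact mul_nonpos_of_nonneg_of_nonpos (sub_nonneg.2 (hlam_anti k hk1 hkn))
      (sub_nonpos.2 (habove k hk hkn))
end

section
/- Let n ≥ 1, let λ ∈ ℝ^n with λ_1 ≥ λ_2 ≥ … ≥ λ_n ≥ 0, and let ū ∈ ℝ^n with ū_1 ≥ ū_2 ≥ … ≥ ū_n ≥ 0. Define γ_r := Σ_{r'=r}^{n−1} (λ_{r'} − λ_{r'+1})·ū_{r'} + λ_n·ū_n and δ_j := Σ_{r'=j}^{n−1} λ_{r'+1}·(ū_{r'} − ū_{r'+1}). Let j ∈ {1,…,n} and let a ≥ ū_j, and define r* := n if ū_r ≥ a for all r, and r* := min{ r : ū_r < a } otherwise. Then λ_{r*}·a − γ_{r*}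 − δ_j ≥ 0. -/
theorem le_of_succ_le_between {n : ℕ} {f : ℕ → ℝ}
    (hf : ∀ r, 1 ≤ r → r < n → f (r + 1) ≤ f r) {i k : ℕ} (hi : 1 ≤ i) (hik : i ≤ k)
    (hk : k ≤ n) : f k ≤ f i := by
  induction k, hik using Nat.le_induction with
  | base => exact le_rfl
  | succ m hm ih => exact (hf m (by omega) (by omega)).trans (ih (by omega))

/-- Summation by parts on `[r, n]`. -/
theorem sum_Ico_sub_mul_add_eq {n : ℕ} (f g : ℕ → ℝ) {r : ℕ} (hr : r ≤ n) :
    (∑ i ∈ Finset.Ico r n, (f i - f (i + 1)) * g i) + f n * g n =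
      f r * g r - ∑ i ∈ Finset.Ico r n, f (i + 1) * (g i - g (i + 1)) := by
  induction n, hr using Nat.le_induction with
  | base => simp
  | succ m hm ih =>
    rw [Finset.sum_Ico_succ_top hm, Finset.sum_Ico_succ_top hm]
    linear_combination ih


/-- Theorem 5.1, nonnegativity of the dual multipliers `η`: with
nonincreasing nonnegative weights `λ`, sorted attractions `ū`, the multipliers `γ_r`,
`δ_j` of Algorithm 2, `j ∈ {1,…,n}`, and `a ≥ ū_j`, for `r*` defined as `n` if
`ū_r ≥ a` for all `r` and as `min{r : ū_r < a}` otherwise, one has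
`λ_{r*} a − γ_{r*} − δ_j ≥ 0`. -/
theorem stmt_14 (n : ℕ) (hn : 1 ≤ n)
    (lam ubar : ℕ → ℝ)
    (hlam_anti : ∀ r, 1 ≤ r → r < n → lam (r + 1) ≤ lam r)
    (hlam_last : 0 ≤ lam n)
    (hubar_anti : ∀ r, 1 ≤ r → r < n → ubar (r + 1) ≤ ubar r)
    (hubar_last : 0 ≤ ubar n)
    (γ δ : ℕ → ℝ)
    (hγ : ∀ r, γ r =
      (∑ r' ∈ Finset.Ico r n, (lam r' - lam (r' + 1)) * ubar r') + lam n * ubar n)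
    (hδ : ∀ j, δ j =
      ∑ r' ∈ Finset.Ico j n, lam (r' + 1) * (ubar r' - ubar (r' + 1)))
    (j : ℕ) (hj1 : 1 ≤ j) (hjn : j ≤ n)
    (a : ℝ) (ha : ubar j ≤ a)
    (rstar : ℕ)
    (hrstar_all : (∀ r, 1 ≤ r → r ≤ n → a ≤ ubar r) → rstar = n)
    (hrstar_min : (∃ r, 1 ≤ r ∧ r ≤ n ∧ ubar r < a) →
      1 ≤ rstar ∧ rstar ≤ n ∧ ubar rstar < a ∧ ∀ r, 1 ≤ r → r < rstar → a ≤ ubar r) :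
    0 ≤ lam rstar * a - γ rstar - δ j := by
  have hlam_nonneg : ∀ r, 1 ≤ r → r ≤ n → 0 ≤ lam r := fun r h1 h2 =>
    hlam_last.trans (le_of_succ_le_between hlam_anti h1 h2 le_rfl)
  have hstar : 1 ≤ rstar ∧ rstar ≤ n ∧ ubar rstar ≤ a ∧
      ∀ r, 1 ≤ r → r < rstar → a ≤ ubar r := by
    by_cases h : ∃ r, 1 ≤ r ∧ r ≤ n ∧ ubar r < a
    · obtain ⟨h1, h2, h3, h4⟩ := hrstar_min h
      exact ⟨h1, h2, h3.le, h4⟩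
    · push Not at h
      obtain rfl := hrstar_all h
      exact ⟨hn, le_rfl, (le_of_succ_le_between hubar_anti hj1 hjn le_rfl).trans ha,
        fun r h1 h2 => h r h1 h2.le⟩
  obtain ⟨hr1, hrn, hra, hbefore⟩ := hstar
  rw [hγ, hδ, sum_Ico_sub_mul_add_eq lam ubar hrn]
  have hgap : 0 ≤ lam rstar * (a - ubar rstar) :=
    mul_nonneg (hlam_nonneg _ hr1 hrn) (sub_nonneg.2 hra)
  rcases le_or_gt rstar j with hle | hlt
  · rw [← Finset.sum_Ico_consecutive _ hle hjn]
    have hsum : 0 ≤ ∑ i ∈ Finset.Ico rstar j, lam (i + 1) * (ubar i - ubar (i + 1)) := by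
      refine Finset.sum_nonneg fun i hi => ?_
      rw [Finset.mem_Ico] at hi
      exact mul_nonneg (hlam_nonneg _ (by omega) (by omega))
        (sub_nonneg.2 (hubar_anti i (by omega) (by omega)))
    linarith
  · rw [← Finset.sum_Ico_consecutive _ hlt.le hrn]
    obtain ⟨m, rfl⟩ : ∃ m, rstar = m + 1 := ⟨rstar - 1, by omega⟩
    have hjm : j ≤ m := by omega
    rw [Finset.sum_Ico_succ_top hjm]
    have hsum : ∑ i ∈ Finset.Ico j m, lam (i + 1) * (ubar i - ubar (i + 1)) ≤ 0 := by
      refine Finset.sum_nonpos fun i hi => ?_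
      rw [Finset.mem_Ico] at hi
      refine mul_nonpos_of_nonneg_of_nonpos (hlam_nonneg _ (by omega) (by omega))
        (sub_nonpos.2 ?_)
      exact ((le_of_succ_le_between hubar_anti hj1 hi.1 (by omega)).trans ha).trans
        (hbefore (i + 1) (by omega) (by omega))
    have hlast : 0 ≤ lam (m + 1) * (a - ubar m) :=
      mul_nonneg (hlam_nonneg _ hr1 hrn)
        (sub_nonneg.2 ((le_of_succ_le_between hubar_anti hj1 hjm (by omega)).trans ha))
    linarith
end

section
/- Let n ≥ 1 (locations), K ≥ 1 (types), and λ ∈ ℝ^n with λ_1 ≥ … ≥ λ_n ≥ 0. For each j ∈ {1,…,n} let 0 ≤ a_{j1} ≤ … ≤ a_{jK}. Let x̄ ∈ {0,1}^{n×K} with Σ_k x̄_{jk} ≤ 1 for every j, set ū_j := Σ_k a_{jk} x̄_{jk}, and assume (after relabeling locations) that ū_1 ≥ ū_2 ≥ … ≥ ū_n. Define γ_r := Σ_{r'=r}^{n−1} (λ_{r'} − λ_{r'+1})·ū_{r'} + λ_n·ū_n, δ_j := Σ_{r'=j}^{n−1} λ_{r'+1}·(ū_{r'} − ū_{r'+1}),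 and for each (j,k): r*_{jk} := n if ū_r ≥ a_{jk} for all r and r*_{jk} := min{ r : ū_r < a_{jk} } otherwise, and η_{jk} := λ_{r*_{jk}}·a_{jk} − γ_{r*_{jk}} − δ_j. Let k̄_j be the unique k with x̄_{jk} = 1 if such k exists, and k̄_j := 0 otherwise. Then for every x ∈ {0,1}^{n×K} with Σ_k x_{jk} ≤ 1 for every j and u_j := Σ_k a_{jk} x_{jk}: Σ_{r=1}^n λ_r u_{(r)} ≤ Σ_{r=1}^n λ_r ū_r + Σ_{j=1}^n Σ_{k > k̄_j} η_{jk}·x_{jk}. -/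
/-- A real sequence that is nondecreasing on `[1, s]` and nonincreasing on `[s, n]` attains its
maximum over `[1, n]` at `s`. -/
theorem le_of_unimodal {f : ℕ → ℝ} {n s : ℕ}
    (hup : ∀ t, 1 ≤ t → t < s → f t ≤ f (t + 1))
    (hdown : ∀ t, s ≤ t → t < n → f (t + 1) ≤ f t) {r : ℕ} (hr : 1 ≤ r) (hrn : r ≤ n) :
    f r ≤ f s := by
  rcases le_total r s with h | h
  · have key : ∀ m, r ≤ m → m ≤ s → f r ≤ f m := by
      intro m hm
      induction m, hm using Nat.le_induction with
      | base => exact fun _ => le_rfl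
      | succ m hm ih => exact fun hms => (ih (by omega)).trans (hup m (by omega) (by omega))
    exact key s h le_rfl
  · have key : ∀ m, s ≤ m → m ≤ n → f m ≤ f s := by
      intro m hm
      induction m, hm using Nat.le_induction with
      | base => exact fun _ => le_rfl
      | succ m hm ih => exact fun hmn => (hdown m hm (by omega)).trans (ih (by omega))
    exact key r h hrn

/-- A `0`-`1` family on a finite set with sum at most one vanishes or is the indicator of a
single element. -/
theorem eq_zero_or_exists_eq_one_of_sum_le_one {ι : Type*} {S : Finset ι} {x : ι → ℝ}
    (hbin : ∀ k, x k = 0 ∨ x k = 1) (hsum : ∑ k ∈ S, x k ≤ 1) :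
    (∀ k ∈ S, x k = 0) ∨ ∃ k ∈ S, x k = 1 ∧ ∀ l ∈ S, l ≠ k → x l = 0 := by
  classical
  by_cases h : ∀ k ∈ S, x k = 0
  · exact Or.inl h
  push Not at h
  obtain ⟨k, hk, hk0⟩ := h
  have hk1 : x k = 1 := (hbin k).resolve_left hk0
  refine Or.inr ⟨k, hk, hk1, fun l hl hlk => (hbin l).resolve_right fun hl1 => ?_⟩
  have hnn : ∀ i, 0 ≤ x i := fun i => by rcases hbin i with h | h <;> simp [h]
  have hle : ∑ i ∈ {l, k}, x i ≤ ∑ i ∈ S, x i :=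
    Finset.sum_le_sum_of_subset_of_nonneg
      (by intro i; simp only [Finset.mem_insert, Finset.mem_singleton]; rintro (rfl | rfl) <;>
        assumption)
      (fun i _ _ => hnn i)
  rw [Finset.sum_pair hlk] at hle
  linarith

/-- validity of the generalized Benders cut (36): with locations relabeled
so that the attractions `ū_j = Σ_k a_{jk} x̄_{jk}` induced by the fixed integer decision
`x̄` are nonincreasing, and with the dual multipliers `γ, δ, η` of Algorithm 2 and the
installed types `k̄_j`, every feasible binary decision `x` with induced attractions `u`
satisfies `Σ_r λ_r u_{(r)} ≤ Σ_r λ_r ū_r + Σ_j Σ_{k > k̄_j} η_{jk} x_{jk}`, where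
`u_{(r)} = u (ρ r)` for any bijection `ρ` of `{1,…,n}` sorting `u` nonincreasingly. -/
theorem stmt_15 (n K : ℕ) (hn : 1 ≤ n) (hK : 1 ≤ K)
    (lam : ℕ → ℝ)
    (hlam_anti : ∀ r, 1 ≤ r → r < n → lam (r + 1) ≤ lam r)
    (hlam_last : 0 ≤ lam n)
    (a : ℕ → ℕ → ℝ)
    (ha_nonneg : ∀ j k, 1 ≤ j → j ≤ n → 1 ≤ k → k ≤ K → 0 ≤ a j k)
    (ha_mono : ∀ j k, 1 ≤ j → j ≤ n → 1 ≤ k → k < K → a j k ≤ a j (k + 1))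
    (xbar : ℕ → ℕ → ℝ)
    (hxbar_bin : ∀ j k, xbar j k = 0 ∨ xbar j k = 1)
    (hxbar_sum : ∀ j, 1 ≤ j → j ≤ n → ∑ k ∈ Finset.Icc 1 K, xbar j k ≤ 1)
    (ubar : ℕ → ℝ)
    (hubar : ∀ j, 1 ≤ j → j ≤ n → ubar j = ∑ k ∈ Finset.Icc 1 K, a j k * xbar j k)
    (hubar_sorted : ∀ r r', 1 ≤ r → r ≤ r' → r' ≤ n → ubar r' ≤ ubar r)
    (γ δ : ℕ → ℝ)
    (hγ : ∀ r, γ r =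
      (∑ r' ∈ Finset.Ico r n, (lam r' - lam (r' + 1)) * ubar r') + lam n * ubar n)
    (hδ : ∀ j, δ j =
      ∑ r' ∈ Finset.Ico j n, lam (r' + 1) * (ubar r' - ubar (r' + 1)))
    (rstar : ℕ → ℕ → ℕ)
    (hrstar_all : ∀ j k, (∀ r, 1 ≤ r → r ≤ n → a j k ≤ ubar r) → rstar j k = n)
    (hrstar_min : ∀ j k, (∃ r, 1 ≤ r ∧ r ≤ n ∧ ubar r < a j k) →
      1 ≤ rstar j k ∧ rstar j k ≤ n ∧ ubar (rstar j k) < a j k ∧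
        ∀ r, 1 ≤ r → r < rstar j k → a j k ≤ ubar r)
    (η : ℕ → ℕ → ℝ)
    (hη : ∀ j k, η j k = lam (rstar j k) * a j k - γ (rstar j k) - δ j)
    (kbar : ℕ → ℕ)
    (hkbar : ∀ j, 1 ≤ j → j ≤ n →
      (1 ≤ kbar j ∧ kbar j ≤ K ∧ xbar j (kbar j) = 1) ∨
      (kbar j = 0 ∧ ∀ k, 1 ≤ k → k ≤ K → xbar j k = 0)) :
    ∀ x : ℕ → ℕ → ℝ,
      (∀ j k, x j k = 0 ∨ x j k = 1) →
      (∀ j, 1 ≤ j → j ≤ n → ∑ k ∈ Finset.Icc 1 K, x j k ≤ 1) →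
      ∀ u : ℕ → ℝ,
        (∀ j, 1 ≤ j → j ≤ n → u j = ∑ k ∈ Finset.Icc 1 K, a j k * x j k) →
        ∀ ρ : ℕ → ℕ,
          Set.BijOn ρ (Set.Icc 1 n) (Set.Icc 1 n) →
          (∀ r r', 1 ≤ r → r ≤ r' → r' ≤ n → u (ρ r') ≤ u (ρ r)) →
          ∑ r ∈ Finset.Icc 1 n, lam r * u (ρ r) ≤
            (∑ r ∈ Finset.Icc 1 n, lam r * ubar r) +
              ∑ j ∈ Finset.Icc 1 n, ∑ k ∈ Finset.Ioc (kbar j) K, η j k * x j k := by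
  intro x hx_bin hx_sum u hu ρ hρ _
  have hlam_nonneg : ∀ r, 1 ≤ r → r ≤ n → 0 ≤ lam r := by
    intro r hr hrn
    induction hrn using Nat.decreasingInduction with
    | self => exact hlam_last
    | of_succ m hm ih => exact (ih (by omega)).trans (hlam_anti m hr hm)
  have ha_le : ∀ j k l, 1 ≤ j → j ≤ n → 1 ≤ k → k ≤ l → l ≤ K → a j k ≤ a j l := by
    intro j k l hj hjn hk hkl
    induction l, hkl using Nat.le_induction with
    | base => exact fun _ => le_rfl
    | succ m hm ih =>
      exact fun hmK => (ih (by omega)).trans (ha_mono j m hj hjn (by omega) (by omega))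
  have hterm : ∀ j k, 1 ≤ j → j ≤ n → k ∈ Finset.Icc 1 K → 0 ≤ a j k * xbar j k := by
    intro j k hj hjn hk
    obtain ⟨hk1, hkK⟩ := Finset.mem_Icc.1 hk
    rcases hxbar_bin j k with h | h <;> simp [h, ha_nonneg j k hj hjn hk1 hkK]
  have hubar_nonneg : ∀ j, 1 ≤ j → j ≤ n → 0 ≤ ubar j := by
    intro j hj hjn
    rw [hubar j hj hjn]
    exact Finset.sum_nonneg fun k hk => hterm j k hj hjn hk
  have hγ_succ : ∀ r, r < n → γ r = (lam r - lam (r + 1)) * ubar r + γ (r + 1) := by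
    intro r hr
    rw [hγ r, hγ (r + 1), Finset.sum_eq_sum_Ico_succ_bot hr, add_assoc]
  have hδ_succ : ∀ j, j < n → δ j = lam (j + 1) * (ubar j - ubar (j + 1)) + δ (j + 1) := by
    intro j hj
    rw [hδ j, hδ (j + 1), Finset.sum_eq_sum_Ico_succ_bot hj]
  have hγδ : ∀ j, j ≤ n → γ j + δ j = lam j * ubar j := by
    intro j hjn
    induction hjn using Nat.decreasingInduction with
    | self => simp [hγ, hδ]
    | of_succ m hm ih => rw [hγ_succ m hm, hδ_succ m hm]; linarith
  have hmax : ∀ (c : ℝ) (s r : ℕ), s ≤ n → (∀ t, 1 ≤ t → t < s → c ≤ ubar t) →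
      (∀ t, 1 ≤ t → s ≤ t → t < n → ubar t ≤ c) → 1 ≤ s → 1 ≤ r → r ≤ n →
      lam r * c - γ r ≤ lam s * c - γ s := by
    intro c s r hsn hup hdown hs hr hrn
    refine le_of_unimodal (f := fun t => lam t * c - γ t) ?_ ?_ hr hrn
    · intro t ht hts
      have h := mul_nonneg (sub_nonneg.2 (hlam_anti t ht (by omega)))
        (sub_nonneg.2 (hup t ht hts))
      simp only [hγ_succ t (by omega)]
      linarith
    · intro t hst htn
      have h := mul_nonneg (sub_nonneg.2 (hlam_anti t (by omega) htn))
        (sub_nonneg.2 (hdown t (by omega) hst htn))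
      simp only [hγ_succ t htn]
      linarith
  have hlow : ∀ j r c, 1 ≤ j → j ≤ n → 1 ≤ r → r ≤ n → c ≤ ubar j →
      lam r * c ≤ γ r + δ j := by
    intro j r c hj hjn hr hrn hc
    have h₁ := hmax (ubar j) j r hjn (fun t ht htj => hubar_sorted t j ht htj.le hjn)
      (fun t _ hjt htn => hubar_sorted j t hj hjt htn.le) hj hr hrn
    have h₂ := mul_le_mul_of_nonneg_left hc (hlam_nonneg r hr hrn)
    linarith [hγδ j hjn]
  have hhigh : ∀ j k r, 1 ≤ r → r ≤ n → lam r * a j k ≤ γ r + δ j + η j k := by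
    intro j k r hr hrn
    have h : lam r * a j k - γ r ≤ lam (rstar j k) * a j k - γ (rstar j k) := by
      by_cases hall : ∀ r, 1 ≤ r → r ≤ n → a j k ≤ ubar r
      · rw [hrstar_all j k hall]
        exact hmax _ n r le_rfl (fun t ht htn => hall t ht htn.le) (fun t _ h₁ h₂ => by omega)
          hn hr hrn
      · push Not at hall
        obtain ⟨h₁, h₂, h₃, h₄⟩ := hrstar_min j k hall
        exact hmax _ _ r h₂ h₄
          (fun t _ hst htn => (hubar_sorted _ t h₁ hst htn.le).trans h₃.le) h₁ hr hrn
    rw [hη]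
    linarith
  have hdual : ∀ r j, 1 ≤ r → r ≤ n → 1 ≤ j → j ≤ n →
      lam r * u j ≤ γ r + (δ j + ∑ k ∈ Finset.Ioc (kbar j) K, η j k * x j k) := by
    intro r j hr hrn hj hjn
    have hsub : ∀ k ∈ Finset.Ioc (kbar j) K, k ∈ Finset.Icc 1 K := fun k hk => by
      simp only [Finset.mem_Ioc, Finset.mem_Icc] at hk ⊢
      omega
    rcases eq_zero_or_exists_eq_one_of_sum_le_one (hx_bin j) (hx_sum j hj hjn) with
      h0 | ⟨k, hk, hk1, hk0⟩
    · have hu0 : u j = 0 := by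
        rw [hu j hj hjn]
        exact Finset.sum_eq_zero fun k hk => by rw [h0 k hk, mul_zero]
      rw [Finset.sum_eq_zero fun k hk => by rw [h0 k (hsub k hk), mul_zero], hu0, add_zero]
      exact hlow j r 0 hj hjn hr hrn (hubar_nonneg j hj hjn)
    · have huk : u j = a j k := by
        rw [hu j hj hjn, Finset.sum_eq_single_of_mem k hk
          fun l hl hlk => by rw [hk0 l hl hlk, mul_zero], hk1, mul_one]
      obtain ⟨hk_pos, hkK⟩ := Finset.mem_Icc.1 hk
      rw [huk]
      rcases le_or_gt k (kbar j) with hkk | hkk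
      · rw [Finset.sum_eq_zero, add_zero]
        · refine hlow j r _ hj hjn hr hrn ?_
          obtain ⟨h₁, h₂, h₃⟩ | ⟨h₁, _⟩ := hkbar j hj hjn
          · have h := Finset.single_le_sum (fun l hl => hterm j l hj hjn hl)
              (Finset.mem_Icc.2 ⟨h₁, h₂⟩)
            rw [← hubar j hj hjn, h₃, mul_one] at h
            exact (ha_le j k _ hj hjn hk_pos hkk h₂).trans h
          · omega
        · intro l hl
          rw [hk0 l (hsub l hl) (by have := (Finset.mem_Ioc.1 hl).1; omega), mul_zero]
      · rw [Finset.sum_eq_single_of_mem k (Finset.mem_Ioc.2 ⟨hkk, hkK⟩)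
          fun l hl hlk => by rw [hk0 l (hsub l hl) hlk, mul_zero], hk1, mul_one, ← add_assoc]
        exact hhigh j k r hr hrn
  have hreindex : ∀ g : ℕ → ℝ,
      ∑ r ∈ Finset.Icc 1 n, g (ρ r) = ∑ j ∈ Finset.Icc 1 n, g j := by
    intro g
    refine Finset.sum_nbij ρ ?_ ?_ ?_ fun _ _ => rfl
    · intro r hr
      exact Finset.mem_Icc.2 (hρ.mapsTo (Finset.mem_Icc.1 hr))
    · simpa only [Finset.coe_Icc] using hρ.injOn
    · simpa only [Finset.coe_Icc] using hρ.surjOn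
  calc ∑ r ∈ Finset.Icc 1 n, lam r * u (ρ r)
      ≤ ∑ r ∈ Finset.Icc 1 n,
          (γ r + (δ (ρ r) + ∑ k ∈ Finset.Ioc (kbar (ρ r)) K, η (ρ r) k * x (ρ r) k)) := by
        refine Finset.sum_le_sum fun r hr => ?_
        have hr := Finset.mem_Icc.1 hr
        have hρr := hρ.mapsTo hr
        exact hdual r (ρ r) hr.1 hr.2 hρr.1 hρr.2
    _ = (∑ r ∈ Finset.Icc 1 n, lam r * ubar r) +
          ∑ j ∈ Finset.Icc 1 n, ∑ k ∈ Finset.Ioc (kbar j) K, η j k * x j k := by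
        rw [Finset.sum_add_distrib,
          hreindex fun j => δ j + ∑ k ∈ Finset.Ioc (kbar j) K, η j k * x j k,
          Finset.sum_add_distrib, ← add_assoc, ← Finset.sum_add_distrib,
          Finset.sum_congr rfl fun j hj => hγδ j (Finset.mem_Icc.1 hj).2]
end
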